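/- arXiv:1809.01306 — 2 statements merged into one kernel-verified Lean document; each statement's English description precedes it below -/
import Mathlib

section
/- Let φ ≥ 0 and n ≥ 1 be natural numbers, and let u ≥ 0, v ≥ 0, B > 0, c ≥ 0 be real numbers. Then ∫_c^{∞} (u x + v)^{φ} x^{n−1} e^{−B x} dx = Σ_{m=0}^{φ} C(φ, m) u^m v^{φ−m} · ((n+m−1)!/B^{n+m}) · e^{−B c} Σ_{j=0}^{n+m−1} (B c)^j / j!. -/
open Real Finset

theorem hasDerivAt_exp_neg_mul_sum_pow_div_factorial (k : ℕ) (y : ℝ) :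
    HasDerivAt (fun y : ℝ ↦ Real.exp (-y) * ∑ j ∈ Finset.range (k + 1), y ^ j / (j.factorial : ℝ))
      (-(Real.exp (-y) * (y ^ k / (k.factorial : ℝ)))) y := by
  have hexp : HasDerivAt (fun y : ℝ ↦ Real.exp (-y)) (-Real.exp (-y)) y := by
    simpa using (hasDerivAt_neg y).exp
  induction k with
  | zero => simpa using hexp
  | succ k ih =>
    have hpow := hexp.mul ((hasDerivAt_pow (k + 1) y).div_const ((k + 1).factorial : ℝ))
    have hsum := ih.add hpow
    refine (hsum.congr_deriv ?_).congr_of_eventuallyEq (.of_forall fun z ↦ ?_)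
    · have := Nat.factorial_ne_zero k
      simp only [Nat.factorial_succ, Nat.add_sub_cancel]
      push_cast
      field_simp
      ring
    · simp only [Pi.add_apply, Pi.mul_apply]
      rw [Finset.sum_range_succ _ (k + 1)]
      ring

theorem tendsto_exp_neg_mul_sum_pow_div_factorial (k : ℕ) :
    Filter.Tendsto
      (fun y : ℝ ↦ Real.exp (-y) * ∑ j ∈ Finset.range k, y ^ j / (j.factorial : ℝ))
      Filter.atTop (nhds 0) := by
  have h := tendsto_finsetSum (Finset.range k) fun j _ ↦
    (Real.tendsto_pow_mul_exp_neg_atTop_nhds_zero j).div_const (j.factorial : ℝ)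
  simp only [zero_div, Finset.sum_const_zero] at h
  refine h.congr fun y ↦ ?_
  rw [Finset.mul_sum]
  exact Finset.sum_congr rfl fun j _ ↦ by ring

theorem hasDerivAt_pow_mul_exp_neg_mul_primitive (k : ℕ) {B : ℝ} (hB : 0 < B) (x : ℝ) :
    HasDerivAt
      (fun x : ℝ ↦ -((k.factorial : ℝ) / B ^ (k + 1)) * (Real.exp (-(B * x)) *
        ∑ j ∈ Finset.range (k + 1), (B * x) ^ j / (j.factorial : ℝ)))
      (x ^ k * Real.exp (-B * x)) x := by
  have h := ((hasDerivAt_exp_neg_mul_sum_pow_div_factorial k (B * x)).comp x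
    ((hasDerivAt_id x).const_mul B)).const_mul (-((k.factorial : ℝ) / B ^ (k + 1)))
  refine h.congr_deriv ?_
  have := Nat.factorial_ne_zero k
  rw [neg_mul B x, mul_pow]
  field_simp
  ring

theorem tendsto_pow_mul_exp_neg_mul_primitive (k : ℕ) {B : ℝ} (hB : 0 < B) :
    Filter.Tendsto
      (fun x : ℝ ↦ -((k.factorial : ℝ) / B ^ (k + 1)) * (Real.exp (-(B * x)) *
        ∑ j ∈ Finset.range (k + 1), (B * x) ^ j / (j.factorial : ℝ)))
      Filter.atTop (nhds 0) := by
  simpa using ((tendsto_exp_neg_mul_sum_pow_div_factorial (k + 1)).comp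
    (Filter.tendsto_id.const_mul_atTop hB)).const_mul (-((k.factorial : ℝ) / B ^ (k + 1)))

theorem integrableOn_Ioi_pow_mul_exp_neg_mul (k : ℕ) {B c : ℝ} (hB : 0 < B) (hc : 0 ≤ c) :
    MeasureTheory.IntegrableOn (fun x : ℝ ↦ x ^ k * Real.exp (-B * x)) (Set.Ioi c) :=
  MeasureTheory.integrableOn_Ioi_deriv_of_nonneg'
    (fun x _ ↦ hasDerivAt_pow_mul_exp_neg_mul_primitive k hB x)
    (fun _ hx ↦ mul_nonneg (pow_nonneg (hc.trans (le_of_lt hx)) k) (Real.exp_pos _).le)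
    (tendsto_pow_mul_exp_neg_mul_primitive k hB)

/-- The upper incomplete gamma function with integer shape. -/
theorem integral_Ioi_pow_mul_exp_neg_mul (k : ℕ) {B c : ℝ} (hB : 0 < B) (hc : 0 ≤ c) :
    ∫ x in Set.Ioi c, x ^ k * Real.exp (-B * x) =
      (k.factorial : ℝ) / B ^ (k + 1) * Real.exp (-B * c) *
        ∑ j ∈ Finset.range (k + 1), (B * c) ^ j / (j.factorial : ℝ) := by
  rw [MeasureTheory.integral_Ioi_of_hasDerivAt_of_tendsto'
    (fun x _ ↦ hasDerivAt_pow_mul_exp_neg_mul_primitive k hB x)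
    (integrableOn_Ioi_pow_mul_exp_neg_mul k hB hc)
    (tendsto_pow_mul_exp_neg_mul_primitive k hB), neg_mul B c]
  ring

/-- Closed form of `∫_c^∞ (u x + v)^φ x^(n-1) e^(-B x) dx` via the binomial
expansion and the upper incomplete gamma function with integer shape. -/
theorem binomial_upper_gamma_integral
    (φ n : ℕ) (hn : 1 ≤ n) (u v B c : ℝ) (hu : 0 ≤ u) (hv : 0 ≤ v) (hB : 0 < B)
    (hc : 0 ≤ c) :
    ∫ x in Set.Ioi c, (u * x + v) ^ φ * x ^ (n - 1) * Real.exp (-B * x) =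
      ∑ m ∈ Finset.range (φ + 1),
        (Nat.choose φ m : ℝ) * u ^ m * v ^ (φ - m) *
          ((Nat.factorial (n + m - 1) : ℝ) / B ^ (n + m)) *
          Real.exp (-B * c) *
          ∑ j ∈ Finset.range (n + m), (B * c) ^ j / (Nat.factorial j : ℝ) := by
  obtain ⟨n, rfl⟩ := Nat.exists_eq_add_of_le' hn
  have hexpand (x : ℝ) : (u * x + v) ^ φ * x ^ (n + 1 - 1) * Real.exp (-B * x) =
      ∑ m ∈ Finset.range (φ + 1),
        (Nat.choose φ m : ℝ) * u ^ m * v ^ (φ - m) * (x ^ (n + m) * Real.exp (-B * x)) := by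
    rw [add_pow, Finset.sum_mul, Finset.sum_mul]
    refine Finset.sum_congr rfl fun m _ ↦ ?_
    rw [Nat.add_sub_cancel, mul_pow, pow_add]
    ring
  simp only [hexpand]
  rw [MeasureTheory.integral_finsetSum _ fun m _ ↦
    (integrableOn_Ioi_pow_mul_exp_neg_mul (n + m) hB hc).const_mul _]
  refine Finset.sum_congr rfl fun m _ ↦ ?_
  rw [MeasureTheory.integral_const_mul, integral_Ioi_pow_mul_exp_neg_mul (n + m) hB hc,
    show n + 1 + m = n + m + 1 by ring, Nat.add_sub_cancel]
  ring
end

section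
/- Let a ≥ 1 and L ≥ 1 be natural numbers, and let r > 0 and A > 0 be real numbers. Then lim_{γ → ∞} γ^{aL} · (1 − e^{−r A/γ} Σ_{k=0}^{a−1} (r A/γ)^k/k!)^{L} = (r A)^{aL} / (a!)^{L}. Consequently, writing S(γ) = (1 − e^{−r A/γ} Σ_{k=0}^{a−1} (r A/γ)^k/k!)^{L}, one has lim_{γ → ∞} (−log S(γ)/log γ) = aL. -/
open Real Finset Filter Topology

/-- The Erlang distribution function of shape `a` and unit rate is equivalent to `x ^ a / a!`
at the origin. -/
theorem tendsto_one_sub_exp_neg_mul_sum_div_pow (a : ℕ) :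
    Tendsto (fun x : ℝ =>
        (1 - Real.exp (-x) * ∑ k ∈ Finset.range a, x ^ k / (Nat.factorial k : ℝ)) / x ^ a)
      (𝓝[≠] 0) (𝓝 (1 / (Nat.factorial a : ℝ))) := by
  have hrem : Tendsto (fun x : ℝ =>
      (Real.exp x - ∑ k ∈ Finset.range (a + 1), x ^ k / (Nat.factorial k : ℝ)) / x ^ a)
      (𝓝[≠] 0) (𝓝 0) :=
    ((Real.exp_sub_sum_range_succ_isLittleO_pow a).tendsto_div_nhds_zero).mono_left
      nhdsWithin_le_nhds
  have hexp : Tendsto (fun x : ℝ => Real.exp (-x)) (𝓝[≠] 0) (𝓝 1) := by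
    have h : Continuous fun x : ℝ => Real.exp (-x) := by fun_prop
    simpa using (h.tendsto 0).mono_left nhdsWithin_le_nhds
  have hprod := hexp.mul (hrem.add_const (1 / (Nat.factorial a : ℝ)))
  rw [zero_add, one_mul] at hprod
  refine hprod.congr' ?_
  filter_upwards [self_mem_nhdsWithin] with x hx
  have hx : x ≠ 0 := hx
  have hinv : Real.exp (-x) * Real.exp x = 1 := by rw [← Real.exp_add]; simp
  rw [one_div, ← hinv, Finset.sum_range_succ]
  generalize Real.exp (-x) = e
  field_simp
  ring

/-- A function asymptotic to `c * x ^ (-n)` with `c > 0` has logarithmic decay rate `n`. -/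
theorem tendsto_neg_log_div_log_of_tendsto_pow_mul {f : ℝ → ℝ} {n : ℕ} {c : ℝ} (hc : 0 < c)
    (h : Tendsto (fun x => x ^ n * f x) atTop (𝓝 c)) :
    Tendsto (fun x => -Real.log (f x) / Real.log x) atTop (𝓝 (n : ℝ)) := by
  have hlog := ((h.log hc.ne').div_atTop Real.tendsto_log_atTop).const_sub (n : ℝ)
  rw [sub_zero] at hlog
  refine hlog.congr' ?_
  filter_upwards [h.eventually (lt_mem_nhds hc), eventually_gt_atTop 1] with x hpos hx
  have hx0 : 0 < x := zero_lt_one.trans hx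
  have hlx : Real.log x ≠ 0 := (Real.log_pos hx).ne'
  have hf : f x ≠ 0 := right_ne_zero_of_mul hpos.ne'
  rw [Real.log_mul (pow_pos hx0 n).ne' hf, Real.log_pow]
  field_simp
  ring

/-- Secrecy diversity order: with
`S(γ) = (1 - e^(-r A/γ) ∑_{k<a} (r A/γ)^k/k!)^L`, one has
`γ^(a L) S(γ) → (r A)^(a L)/(a!)^L` and `-log S(γ)/log γ → a L` as `γ → ∞`. -/
theorem secrecy_diversity_order (a L : ℕ) (ha : 1 ≤ a) (hL : 1 ≤ L)
    (r A : ℝ) (hr : 0 < r) (hA : 0 < A) :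
    Filter.Tendsto
      (fun γ : ℝ =>
        γ ^ (a * L) *
          (1 - Real.exp (-r * (A / γ)) *
              ∑ k ∈ Finset.range a, (r * (A / γ)) ^ k / (Nat.factorial k : ℝ)) ^ L)
      Filter.atTop
      (nhds ((r * A) ^ (a * L) / ((Nat.factorial a : ℝ)) ^ L)) ∧
    Filter.Tendsto
      (fun γ : ℝ =>
        -Real.log
            ((1 - Real.exp (-r * (A / γ)) *
                ∑ k ∈ Finset.range a, (r * (A / γ)) ^ k / (Nat.factorial k : ℝ)) ^ L) /
          Real.log γ)
      Filter.atTop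
      (nhds ((a * L : ℕ) : ℝ)) := by
  have hx : Tendsto (fun γ : ℝ => r * (A / γ)) atTop (𝓝[≠] 0) := by
    refine tendsto_nhdsWithin_iff.2 ⟨?_, ?_⟩
    · simpa using (tendsto_const_nhds (x := A)).div_atTop tendsto_id |>.const_mul r
    · filter_upwards [eventually_gt_atTop 0] with γ hγ
      exact (mul_pos hr (div_pos hA hγ)).ne'
  have hlim := (((tendsto_one_sub_exp_neg_mul_sum_div_pow a).comp hx).const_mul
    ((r * A) ^ a)).pow L
  rw [mul_one_div, div_pow, ← pow_mul] at hlim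
  have hmain := hlim.congr' (f₂ := fun γ : ℝ => γ ^ (a * L) *
      (1 - Real.exp (-r * (A / γ)) *
        ∑ k ∈ Finset.range a, (r * (A / γ)) ^ k / (Nat.factorial k : ℝ)) ^ L) <| by
    filter_upwards [eventually_gt_atTop 0] with γ hγ
    have hscale : (r * A) ^ a = γ ^ a * (r * (A / γ)) ^ a := by
      rw [← mul_pow]
      congr 1
      field_simp
    have hpow : (r * (A / γ)) ^ a ≠ 0 := by positivity
    rw [Function.comp_apply, hscale, pow_mul, ← mul_pow _ _ L, neg_mul, mul_assoc,
      mul_div_cancel₀ _ hpow]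
  exact ⟨hmain, tendsto_neg_log_div_log_of_tendsto_pow_mul (by positivity) hmain⟩
end
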